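/- Let 0 < R0 < r' < r and κ_t ∈ ℝ, and set μ_d(r) = −√(1 − R0²/r²). Then ∫_{μ_d(r)}^{−√(1 − r'²/r²)} exp(κ_t(rμ + √(r²μ² − r² + r'²))) / √(r²μ² − r² + r'²) dμ = (1/r) ∫_{√(r'²−R0²) − √(r²−R0²)}^{−√(r²−r'²)} e^{κ_t ν}/ν dν, where the left-hand side is an (absolutely convergent) improper integral and the right-hand side is an oriented interval integral. -/

import Mathlib

open Real Set MeasureTheory

/-- The direction cosine `-√(1 - c² / r²)`, scaled by `r`, is `-√(r² - c²)`. -/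
lemma mul_neg_sqrt_one_sub_sq_div {r : ℝ} (hr : 0 < r) (c : ℝ) :
    r * -Real.sqrt (1 - c^2 / r^2) = -Real.sqrt (r^2 - c^2) := by
  have h : r^2 - c^2 = r^2 * (1 - c^2 / r^2) := by field_simp
  rw [h, Real.sqrt_mul (sq_nonneg r), Real.sqrt_sq hr.le, mul_neg]

/-- Derivative of `μ ↦ r μ + √(r² μ² - r² + s²)`, expressed through the function itself. -/
lemma hasDerivAt_mul_add_sqrt {r s μ : ℝ} (h : 0 < r^2 * μ^2 - r^2 + s^2) :
    HasDerivAt (fun x : ℝ => r * x + Real.sqrt (r^2 * x^2 - r^2 + s^2))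
      (r * (r * μ + Real.sqrt (r^2 * μ^2 - r^2 + s^2)) / Real.sqrt (r^2 * μ^2 - r^2 + s^2)) μ := by
  have hS := Real.sqrt_pos.2 h
  have h1 : HasDerivAt (fun x : ℝ => r^2 * x^2 - r^2 + s^2) (r^2 * (2 * μ)) μ := by
    simpa using ((((hasDerivAt_id μ).pow 2).const_mul (r^2)).sub_const (r^2)).add_const (s^2)
  refine (((hasDerivAt_id μ).const_mul r).add (h1.sqrt h.ne')).congr_deriv ?_
  generalize Real.sqrt (r^2 * μ^2 - r^2 + s^2) = S at hS ⊢
  field_simp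
  ring

/-- If `|s| < |r|` and `r μ < 0`, then `r μ + √(r² μ² - r² + s²)` is negative. -/
lemma mul_add_sqrt_neg {r s μ : ℝ} (hsr : s^2 < r^2) (hμ : r * μ < 0) :
    r * μ + Real.sqrt (r^2 * μ^2 - r^2 + s^2) < 0 := by
  have : Real.sqrt (r^2 * μ^2 - r^2 + s^2) < -(r * μ) :=
    (Real.sqrt_lt' (by linarith)).2 (by nlinarith)
  linarith

/-- Substitution `ν = rμ + √(r²μ² − r² + r'²)` in the inner `μ`-integral of the
term `I_2` of the integral equation for the importance function. -/
theorem I2_substitution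
    (R0 r' r κt : ℝ) (hR0 : 0 < R0) (hr' : R0 < r') (hr : r' < r) :
    ∫ μ in (-Real.sqrt (1 - R0^2 / r^2))..(-Real.sqrt (1 - r'^2 / r^2)),
        Real.exp (κt * (r * μ + Real.sqrt (r^2 * μ^2 - r^2 + r'^2)))
          / Real.sqrt (r^2 * μ^2 - r^2 + r'^2)
      = (1 / r) * ∫ ν in (Real.sqrt (r'^2 - R0^2) - Real.sqrt (r^2 - R0^2))..
            (-Real.sqrt (r^2 - r'^2)),
          Real.exp (κt * ν) / ν := by
  have hr0 : 0 < r := by linarith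
  have hsr : r'^2 < r^2 := by nlinarith
  have hRs : R0^2 < r'^2 := by nlinarith
  have ha := mul_neg_sqrt_one_sub_sq_div hr0 R0
  have hb := mul_neg_sqrt_one_sub_sq_div hr0 r'
  have hbpos : 0 < Real.sqrt (r^2 - r'^2) := Real.sqrt_pos.2 (by linarith)
  have hbsq := Real.sq_sqrt (show 0 ≤ r^2 - r'^2 by linarith)
  have hasq := Real.sq_sqrt (show 0 ≤ r^2 - R0^2 by linarith)
  set a := -Real.sqrt (1 - R0^2 / r^2)
  set b := -Real.sqrt (1 - r'^2 / r^2)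
  have hab : a ≤ b := by
    have : Real.sqrt (r^2 - r'^2) ≤ Real.sqrt (r^2 - R0^2) :=
      Real.sqrt_le_sqrt (by linarith)
    exact le_of_mul_le_mul_left (by linarith) hr0
  let f : ℝ → ℝ := fun μ => r * μ + Real.sqrt (r^2 * μ^2 - r^2 + r'^2)
  have hneg : ∀ μ, μ ≤ b → f μ < 0 := fun μ hμ =>
    mul_add_sqrt_neg hsr (by nlinarith [mul_le_mul_of_nonneg_left hμ hr0.le])
  have hfa : f a = Real.sqrt (r'^2 - R0^2) - Real.sqrt (r^2 - R0^2) := by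
    have : r^2 * a^2 - r^2 + r'^2 = r'^2 - R0^2 := by
      rw [← mul_pow, ha, neg_sq, hasq]; ring
    simp only [f]
    rw [this, ha]; ring
  have hfb : f b = -Real.sqrt (r^2 - r'^2) := by
    have : r^2 * b^2 - r^2 + r'^2 = 0 := by
      rw [← mul_pow, hb, neg_sq, hbsq]; ring
    simp only [f]
    rw [this, hb, Real.sqrt_zero, add_zero]
  have key := intervalIntegral.integral_comp_mul_deriv_of_deriv_nonpos (a := a) (b := b)
    (f := f) (f' := fun μ => r * f μ / Real.sqrt (r^2 * μ^2 - r^2 + r'^2))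
    (g := fun ν => Real.exp (κt * ν) / ν) (by fun_prop)
    (by
      rw [min_eq_left hab, max_eq_right hab]
      intro μ hμ
      have h1 : r * μ < r * b := mul_lt_mul_of_pos_left hμ.2 hr0
      exact hasDerivAt_mul_add_sqrt (by nlinarith))
    (by
      rw [min_eq_left hab, max_eq_right hab]
      intro μ hμ
      exact div_nonpos_of_nonpos_of_nonneg
        (mul_nonpos_of_nonneg_of_nonpos hr0.le (hneg μ hμ.2.le).le) (Real.sqrt_nonneg _))
  rw [← hfa, ← hfb, ← key, ← intervalIntegral.integral_const_mul]
  refine intervalIntegral.integral_congr fun μ hμ => ?_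
  rw [uIcc_of_le hab] at hμ
  have hf := (hneg μ hμ.2).ne
  change Real.exp (κt * f μ) / _ = 1 / r * (Real.exp (κt * f μ) / f μ * (r * f μ / _))
  field_simp
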